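/- Let 0 < t < ∞ and 1 < p, q < ∞. There exist constants c, C > 0 depending only on n, p, q (and not on t) such that for every cube Q ⊂ ℝ^n with side length at least t, c |Q|^{1/q} ≤ ‖χ_Q‖_{(E_p^q)_t} ≤ C |Q|^{1/q}, where χ_Q is the characteristic function of Q. -/

import Mathlib

open MeasureTheory ENNReal Metric

noncomputable section

/-- The (closed) cube centered at `x` with side length `r`. -/
def cube {n : ℕ} (x : EuclideanSpace ℝ (Fin n)) (r : ℝ) : Set (EuclideanSpace ℝ (Fin n)) :=
  {y | ∀ i, |y i - x i| ≤ r / 2}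

/-- The average `f_Q = |Q|⁻¹ ∫_Q f` of `f` over a set `Q`. -/
def setAvg {n : ℕ} (Q : Set (EuclideanSpace ℝ (Fin n))) (f : EuclideanSpace ℝ (Fin n) → ℝ) : ℝ :=
  (volume Q).toReal⁻¹ * ∫ y in Q, f y

/-- Slice norm of an `ℝ≥0∞`-valued function. -/
def sliceNormE {n : ℕ} (p q t : ℝ) (g : EuclideanSpace ℝ (Fin n) → ℝ≥0∞) : ℝ≥0∞ :=
  (∫⁻ x, ((volume (cube x t))⁻¹ * ∫⁻ y in cube x t, g y ^ p) ^ (q / p)) ^ (1 / q)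

/-- The slice space norm `‖f‖_{(E_p^q)_t}`. -/
def sliceNorm {n : ℕ} (p q t : ℝ) (f : EuclideanSpace ℝ (Fin n) → ℝ) : ℝ≥0∞ :=
  sliceNormE p q t fun y => ENNReal.ofReal |f y|

/-- Membership in the slice space `(E_p^q)_t(ℝⁿ)`. -/
def MemSlice {n : ℕ} (p q t : ℝ) (f : EuclideanSpace ℝ (Fin n) → ℝ) : Prop :=
  Measurable f ∧ sliceNorm p q t f ≠ ∞

/-- The BMO seminorm, as a supremum over all cubes. -/
def bmoNorm {n : ℕ} (b : EuclideanSpace ℝ (Fin n) → ℝ) : ℝ≥0∞ :=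
  ⨆ (x : EuclideanSpace ℝ (Fin n)) (r : ℝ) (_ : 0 < r),
    (volume (cube x r))⁻¹ * ∫⁻ y in cube x r, ENNReal.ofReal |b y - setAvg (cube x r) b|

/-- Membership in `BMO(ℝⁿ)`. -/
def MemBMO {n : ℕ} (b : EuclideanSpace ℝ (Fin n) → ℝ) : Prop :=
  LocallyIntegrable b volume ∧ bmoNorm b ≠ ∞

/-- `Ω` is homogeneous of degree zero. -/
def HomogZero {n : ℕ} (Ω : EuclideanSpace ℝ (Fin n) → ℝ) : Prop :=
  ∀ lam : ℝ, 0 < lam → ∀ x : EuclideanSpace ℝ (Fin n), x ≠ 0 → Ω (lam • x) = Ω x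

/-- `Ω` has mean value zero on the unit sphere. -/
def MeanZeroOnSphere {n : ℕ} (Ω : EuclideanSpace ℝ (Fin n) → ℝ) : Prop :=
  ∫ x : sphere (0 : EuclideanSpace ℝ (Fin n)) 1, Ω x
    ∂((volume : Measure (EuclideanSpace ℝ (Fin n))).toSphere) = 0

/-- The fractional integral operator with rough kernel,
`T_{Ω,α} f (x) = ∫ Ω(x-y) |x-y|^{α-n} f(y) dy`. -/
def fracInt {n : ℕ} (Ω : EuclideanSpace ℝ (Fin n) → ℝ) (α : ℝ)
    (f : EuclideanSpace ℝ (Fin n) → ℝ) (x : EuclideanSpace ℝ (Fin n)) : ℝ :=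
  ∫ y, Ω (x - y) * ‖x - y‖ ^ (α - n) * f y

/-- The commutator `[b, T_{Ω,α}] f = b ⬝ T_{Ω,α} f - T_{Ω,α}(b f)`. -/
def commutatorOp {n : ℕ} (Ω : EuclideanSpace ℝ (Fin n) → ℝ) (α : ℝ)
    (b f : EuclideanSpace ℝ (Fin n) → ℝ) : EuclideanSpace ℝ (Fin n) → ℝ :=
  fun x => b x * fracInt Ω α f x - fracInt Ω α (fun y => b y * f y) x

/-- The fractional maximal operator `M_γ` (over cubes); `γ = 0` gives the
Hardy–Littlewood maximal operator. -/
def fracMax {n : ℕ} (γ : ℝ) (f : EuclideanSpace ℝ (Fin n) → ℝ)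
    (x : EuclideanSpace ℝ (Fin n)) : ℝ≥0∞ :=
  ⨆ (z : EuclideanSpace ℝ (Fin n)) (r : ℝ) (_ : 0 < r) (_ : x ∈ cube z r),
    volume (cube z r) ^ (γ / n - 1) * ∫⁻ y in cube z r, ENNReal.ofReal |f y|

/-- The Fefferman–Stein sharp maximal operator `M^♯`. -/
def sharpMax {n : ℕ} (f : EuclideanSpace ℝ (Fin n) → ℝ)
    (x : EuclideanSpace ℝ (Fin n)) : ℝ≥0∞ :=
  ⨆ (z : EuclideanSpace ℝ (Fin n)) (r : ℝ) (_ : 0 < r) (_ : x ∈ cube z r),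
    (volume (cube z r))⁻¹ * ∫⁻ y in cube z r, ENNReal.ofReal |f y - setAvg (cube z r) f|

/-- The `L^p` norm. -/
def lpNorm {n : ℕ} (p : ℝ) (f : EuclideanSpace ℝ (Fin n) → ℝ) : ℝ≥0∞ :=
  (∫⁻ x, ENNReal.ofReal |f x| ^ p) ^ (1 / p)

/-- The set of admissible Hölder–Lipschitz constants of order `β` for `b`. -/
def LipConstSet {n : ℕ} (β : ℝ) (b : EuclideanSpace ℝ (Fin n) → ℝ) : Set ℝ :=
  {C : ℝ | ∀ x y, |b x - b y| ≤ C * dist x y ^ β}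

/-- Membership in the Lipschitz space `Lip_β(ℝⁿ)`. -/
def MemLip {n : ℕ} (β : ℝ) (b : EuclideanSpace ℝ (Fin n) → ℝ) : Prop :=
  (LipConstSet β b).Nonempty

/-- The `Lip_β` norm: the least admissible constant. -/
def lipNorm {n : ℕ} (β : ℝ) (b : EuclideanSpace ℝ (Fin n) → ℝ) : ℝ :=
  sInf (LipConstSet β b)

theorem volume_cube {n : ℕ} (x : EuclideanSpace ℝ (Fin n)) {r : ℝ} (hr : 0 ≤ r) :
    volume (cube x r) = ENNReal.ofReal r ^ n := by
  have h : cube x r = (WithLp.ofLp : EuclideanSpace ℝ (Fin n) → Fin n → ℝ) ⁻¹'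
      closedBall (WithLp.ofLp x) (r / 2) := by
    ext y
    simp [cube, dist_pi_le_iff (div_nonneg hr zero_le_two), Real.dist_eq]
  rw [h, (PiLp.volume_preserving_ofLp (Fin n)).measure_preimage
    isClosed_closedBall.measurableSet.nullMeasurableSet,
    Real.volume_pi_closedBall _ (by positivity)]
  simp [mul_div_cancel₀, ENNReal.ofReal_pow hr]

theorem measurableSet_cube {n : ℕ} (x : EuclideanSpace ℝ (Fin n)) (r : ℝ) :
    MeasurableSet (cube x r) := by
  have h : IsClosed (cube x r) := by
    simp only [cube, Set.ofPred_forall]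
    exact isClosed_iInter fun i => isClosed_le (by fun_prop) continuous_const
  exact h.measurableSet

/-- The slice norm of a characteristic function, in terms of volumes. -/
theorem sliceNorm_indicator_one {n : ℕ} {p q t : ℝ} (hp : 0 < p)
    {s : Set (EuclideanSpace ℝ (Fin n))} (hs : MeasurableSet s) :
    sliceNorm p q t (s.indicator fun _ => (1 : ℝ)) =
      (∫⁻ z, ((volume (cube z t))⁻¹ * volume (s ∩ cube z t)) ^ (q / p)) ^ (1 / q) := by
  have h : (fun y => ENNReal.ofReal |s.indicator (fun _ => (1 : ℝ)) y| ^ p) =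
      s.indicator 1 := by
    ext y
    by_cases hy : y ∈ s <;> simp [hy, hp]
  unfold sliceNorm sliceNormE
  simp only [h, lintegral_indicator_one hs, Measure.restrict_apply hs]

/-- If the cube centered at `z` meets the larger cube centered at `x`, then `z` lies in the
doubled cube. -/
theorem mem_cube_of_inter_nonempty {n : ℕ} {x z : EuclideanSpace ℝ (Fin n)} {r t : ℝ}
    (htr : t ≤ r) (h : (cube x r ∩ cube z t).Nonempty) : z ∈ cube x (2 * r) := by
  obtain ⟨y, hx, hz⟩ := h
  intro i
  have h1 := abs_le.1 (hx i)
  have h2 := abs_le.1 (hz i)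
  exact abs_le.2 ⟨by linarith, by linarith⟩

/-- A cube of side `t ≤ r` centered in a cube of side `r` meets it in a set containing
a cube of side `t / 2`. -/
theorem exists_cube_subset_inter {n : ℕ} {x z : EuclideanSpace ℝ (Fin n)} {r t : ℝ}
    (ht : 0 < t) (htr : t ≤ r) (hz : z ∈ cube x r) :
    ∃ w, cube w (t / 2) ⊆ cube x r ∩ cube z t := by
  have hr : 0 < r := ht.trans_le htr
  have key (i : Fin n) : t / (2 * r) * |z i - x i| ≤ t / 4 := by
    calc t / (2 * r) * |z i - x i| ≤ t / (2 * r) * (r / 2) := by gcongr; exact hz i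
      _ = t / 4 := by field_simp; norm_num
  have hle : t / (2 * r) ≤ 1 := by rw [div_le_one (by positivity)]; linarith
  refine ⟨z - (t / (2 * r)) • (z - x), fun y hy => ⟨fun i => ?_, fun i => ?_⟩⟩
  · have h1 := hy i
    simp only [PiLp.sub_apply, PiLp.smul_apply, smul_eq_mul] at h1
    have h2 : (1 - t / (2 * r)) * |z i - x i| ≤ r / 2 - t / 4 := by
      calc (1 - t / (2 * r)) * |z i - x i| ≤ (1 - t / (2 * r)) * (r / 2) := by
            gcongr
            exact hz i
        _ = r / 2 - t / 4 := by field_simp; ring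
    calc |y i - x i|
        = |(y i - (z i - t / (2 * r) * (z i - x i))) + (1 - t / (2 * r)) * (z i - x i)| := by
          ring_nf
      _ ≤ t / 2 / 2 + (r / 2 - t / 4) := by
          refine (abs_add_le _ _).trans (add_le_add h1 ?_)
          rwa [abs_mul, abs_of_nonneg (sub_nonneg.2 hle)]
      _ = r / 2 := by ring
  · have h1 := hy i
    simp only [PiLp.sub_apply, PiLp.smul_apply, smul_eq_mul] at h1
    calc |y i - z i|
        = |(y i - (z i - t / (2 * r) * (z i - x i))) - t / (2 * r) * (z i - x i)| := by
          ring_nf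
      _ ≤ t / 2 / 2 + t / 4 := by
          refine (abs_sub _ _).trans (add_le_add h1 ?_)
          rw [abs_mul, abs_of_nonneg (by positivity)]
          exact key i
      _ = t / 2 := by ring

theorem statement8 (n : ℕ) (hn : 1 ≤ n) (p q : ℝ) (hp : 1 < p) (hq : 1 < q) :
    ∃ c > (0 : ℝ), ∃ C > (0 : ℝ), ∀ t : ℝ, 0 < t → ∀ (x : EuclideanSpace ℝ (Fin n)) (r : ℝ), t ≤ r →
      ENNReal.ofReal c * volume (cube x r) ^ (1 / q) ≤
          sliceNorm p q t ((cube x r).indicator fun _ => (1 : ℝ)) ∧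
      sliceNorm p q t ((cube x r).indicator fun _ => (1 : ℝ)) ≤
          ENNReal.ofReal C * volume (cube x r) ^ (1 / q) := by
  have hp0 : 0 < p := one_pos.trans hp
  have hq0 : 0 < q := one_pos.trans hq
  refine ⟨((1 / 2 : ℝ) ^ n) ^ (1 / p), by positivity, ((2 : ℝ) ^ n) ^ (1 / q), by positivity,
    fun t ht x r htr => ?_⟩
  have hr : 0 < r := ht.trans_le htr
  rw [sliceNorm_indicator_one hp0 (measurableSet_cube x r)]
  constructor
  · have hinner : ∀ z ∈ cube x r, ENNReal.ofReal ((1 / 2 : ℝ) ^ n) ≤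
        (volume (cube z t))⁻¹ * volume (cube x r ∩ cube z t) := by
      intro z hz
      obtain ⟨w, hw⟩ := exists_cube_subset_inter ht htr hz
      refine le_trans (le_of_eq ?_) (mul_le_mul_right (measure_mono hw) _)
      rw [volume_cube z ht.le, volume_cube w (by positivity), ← ENNReal.ofReal_pow ht.le,
        ← ENNReal.ofReal_pow (by positivity), ← ENNReal.ofReal_inv_of_pos (by positivity),
        ← ENNReal.ofReal_mul (by positivity), ← inv_pow, ← mul_pow]
      congr 2
      field_simp
    calc ENNReal.ofReal (((1 / 2 : ℝ) ^ n) ^ (1 / p)) * volume (cube x r) ^ (1 / q)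
        = (ENNReal.ofReal ((1 / 2 : ℝ) ^ n) ^ (q / p) * volume (cube x r)) ^ (1 / q) := by
          rw [ENNReal.mul_rpow_of_nonneg _ _ (by positivity), ← ENNReal.rpow_mul,
            ENNReal.ofReal_rpow_of_nonneg (by positivity) (by positivity)]
          congr 3
          field_simp
      _ = (∫⁻ _ in cube x r, ENNReal.ofReal ((1 / 2 : ℝ) ^ n) ^ (q / p)) ^ (1 / q) := by
          rw [setLIntegral_const]
      _ ≤ _ := by
          gcongr ?_ ^ _
          refine (setLIntegral_mono' (measurableSet_cube x r) fun z hz => ?_).trans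
            (setLIntegral_le_lintegral _ _)
          exact ENNReal.rpow_le_rpow (hinner z hz) (by positivity)
  · calc _ ≤ (∫⁻ z, (cube x (2 * r)).indicator 1 z) ^ (1 / q) := by
          gcongr ?_ ^ _
          refine lintegral_mono fun z => ?_
          by_cases hz : z ∈ cube x (2 * r)
          · simp only [Set.indicator_of_mem hz, Pi.one_apply]
            refine ENNReal.rpow_le_one ?_ (by positivity)
            exact (mul_le_mul_right (measure_mono Set.inter_subset_right) _).trans
              (ENNReal.inv_mul_le_one _)
          · have he : cube x r ∩ cube z t = ∅ :=
              Set.not_nonempty_iff_eq_empty.1 fun h => hz (mem_cube_of_inter_nonempty htr h)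
            simp [he, div_pos hq0 hp0]
      _ = _ := by
          rw [lintegral_indicator_one (measurableSet_cube _ _), volume_cube x (by positivity),
            volume_cube x hr.le, ENNReal.ofReal_mul zero_le_two, mul_pow,
            ENNReal.mul_rpow_of_nonneg _ _ (by positivity),
            ← ENNReal.ofReal_rpow_of_nonneg (by positivity) (by positivity),
            ENNReal.ofReal_pow zero_le_two]

end
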